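/- Let G be a finite pseudo-solvable group such that 2, 3, and 5 all divide |G| and {2,3,5} forms a triangle in the complement of the prime graph of G (i.e., G has no element of order 6, no element of order 10, and no element of order 15). Then G has exactly one composition factor isomorphic to A5; more precisely, there exist normal subgroups N ≤ M of G with N solvable, M/N isomorphic to A5, and G/M solvable of order coprime to 30. -/

import Mathlib

/-- A finite group is *pseudo-solvable* if it has a composition series all of whose
factors are cyclic (of prime order) or isomorphic to the alternating group `A₅`.
The factor of a step of the series is expressed as the image of a surjective
homomorphism whose kernel is the previous term. -/
def IsPseudoSolvable (G : Type*) [Group G] : Prop :=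
  ∃ (n : ℕ) (c : Fin (n + 1) → Subgroup G),
    c 0 = ⊥ ∧ c (Fin.last n) = ⊤ ∧
    ∀ i : Fin n,
      c i.castSucc ≤ c i.succ ∧
      ∃ (S : Type) (_ : Group S) (f : ↥(c i.succ) →* S),
        Function.Surjective f ∧
        f.ker = (c i.castSucc).subgroupOf (c i.succ) ∧
        IsSimpleGroup S ∧
        (IsCyclic S ∨ Nonempty (S ≃* alternatingGroup (Fin 5)))

section

open Subgroup

theorem exists_orderOf_eq_mul_of_commute {G : Type*} [Group G] [Finite G] {a b : G} {s t : ℕ}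
    (hab : Commute a b) (hst : s.Coprime t) (ha : s ∣ orderOf a) (hb : t ∣ orderOf b) :
    ∃ g : G, orderOf g = s * t := by
  obtain ⟨m, hm⟩ := ha
  obtain ⟨n, hn⟩ := hb
  have hm0 : m ≠ 0 := by rintro rfl; exact (orderOf_pos a).ne' (by simpa using hm)
  have hn0 : n ≠ 0 := by rintro rfl; exact (orderOf_pos b).ne' (by simpa using hn)
  have h1 : orderOf (a ^ m) = s := by
    rw [orderOf_pow_of_dvd hm0 (hm ▸ dvd_mul_left m s), hm,
      Nat.mul_div_cancel _ (Nat.pos_of_ne_zero hm0)]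
  have h2 : orderOf (b ^ n) = t := by
    rw [orderOf_pow_of_dvd hn0 (hn ▸ dvd_mul_left n t), hn,
      Nat.mul_div_cancel _ (Nat.pos_of_ne_zero hn0)]
  refine ⟨a ^ m * b ^ n, ?_⟩
  rw [(hab.pow_pow m n).orderOf_mul_eq_mul_orderOf_of_coprime (by rwa [h1, h2]), h1, h2]

theorem exists_orderOf_eq_of_map {G H : Type*} [Group G] [Finite G] [Group H] (f : G →* H)
    {n : ℕ} {g : G} (hg : orderOf (f g) = n) : ∃ x : G, orderOf x = n := by
  obtain ⟨m, hm⟩ := hg ▸ orderOf_map_dvd f g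
  have hm0 : m ≠ 0 := by rintro rfl; exact (orderOf_pos g).ne' (by simpa using hm)
  exact ⟨g ^ m, by rw [orderOf_pow_of_dvd hm0 (hm ▸ dvd_mul_left m n), hm,
      Nat.mul_div_cancel _ (Nat.pos_of_ne_zero hm0)]⟩

theorem prod_subgroup_eq_one {G A : Type*} [Group G] [CommGroup A]
    (φ : G →* MulAut A) (H : Subgroup G) [Fintype H]
    (hH : ∃ c ∈ H, ∀ w, φ c w = w → w = 1) (w : A) : ∏ h : H, φ h w = 1 := by
  obtain ⟨c, hc, hfix⟩ := hH
  apply hfix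
  rw [map_prod]
  exact Fintype.prod_equiv (Equiv.mulLeft (⟨c, hc⟩ : H)) _ _ fun h => by simp

/-- If a group `Q` acts on `R` without nontrivial fixed points and both `Q` and `R` contain an
element acting on the abelian group `A` without nontrivial fixed points, then the order of `R`
annihilates `A`. -/
theorem pow_card_eq_one_of_fixedPointFree {G A : Type*} [Group G] [Finite G] [CommGroup A]
    (φ : G →* MulAut A) (R Q : Subgroup G) (hQ : Q ≤ normalizer (R : Set G))
    (hR1 : ∃ c ∈ R, ∀ w, φ c w = w → w = 1) (hQ1 : ∃ c ∈ Q, ∀ w, φ c w = w → w = 1)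
    (hQR : ∀ h ∈ Q, h ≠ 1 → ∀ a ∈ R, Commute h a → a = 1) (v : A) : v ^ Nat.card R = 1 := by
  classical
  have := Fintype.ofFinite R
  have := Fintype.ofFinite Q
  have key : ∏ a : R, ∏ h : Q, φ ((a : G) * h * (a : G)⁻¹) v = 1 := by
    refine Finset.prod_eq_one fun a _ => ?_
    have := congrArg (φ a) (prod_subgroup_eq_one φ Q hQ1 (φ (a : G)⁻¹ v))
    rw [map_prod, map_one] at this
    simpa using this
  rw [Finset.prod_comm, Fintype.prod_eq_single (1 : Q)] at key
  · simpa [Nat.card_eq_fintype_card] using key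
  intro h hne
  have hne' : (h : G) ≠ 1 := by simpa using hne
  have hmem (a : R) : (a : G) * h * (a : G)⁻¹ * (h : G)⁻¹ ∈ R := by
    have := (mem_normalizer_iff.mp (hQ h.2) (a : G)⁻¹).mp (R.inv_mem a.2)
    simpa [mul_assoc] using R.mul_mem a.2 this
  let e : R → R := fun a => ⟨_, hmem a⟩
  have he : Function.Injective e := by
    intro a b hab
    have hab' : (a : G) * h * (a : G)⁻¹ = b * h * (b : G)⁻¹ :=
      mul_right_cancel (congrArg Subtype.val hab)
    have : (b : G)⁻¹ * a = 1 := by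
      refine hQR h h.2 hne' _ (R.mul_mem (R.inv_mem b.2) a.2) ?_
      show (h : G) * ((b : G)⁻¹ * a) = (b : G)⁻¹ * a * h
      have := congrArg (fun z => (b : G)⁻¹ * z * a) hab'
      simpa [mul_assoc] using this.symm
    exact Subtype.ext (inv_mul_eq_one.mp this).symm
  rw [← prod_subgroup_eq_one φ R hR1 (φ h v)]
  refine Fintype.prod_equiv (Equiv.ofBijective e (Finite.injective_iff_bijective.mp he)) _ _
    fun a => ?_
  rw [← MulAut.mul_apply, ← map_mul]
  simp [e]

theorem exists_normal_prime_index {G : Type*} [Group G] [Finite G] [Nontrivial G]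
    [Group.IsSolvable G] : ∃ K : Subgroup G, K.Normal ∧ K.index.Prime := by
  obtain ⟨K, hK, hle⟩ := (eq_top_or_exists_le_coatom (_root_.commutator G)).resolve_left
    (Group.IsSolvable.commutator_lt_top_of_nontrivial G).ne
  have hn : K.Normal := Normal.of_commutator_le G hle
  refine ⟨K, hn, ?_⟩
  have : Nontrivial (G ⧸ K) := QuotientGroup.nontrivial_iff.mpr hK.1
  have hcomm := Normal.quotient_commutative_iff_commutator_le.mpr hle
  let _ : CommGroup (G ⧸ K) := { mul_comm := hcomm.is_comm.comm }
  have : IsSimpleGroup (G ⧸ K) := by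
    refine ⟨fun H _ => ?_⟩
    have hle : K ≤ H.comap (QuotientGroup.mk' K) := fun x hx => by
      simp [(QuotientGroup.eq_one_iff x).mpr hx, H.one_mem]
    rcases hle.lt_or_eq with hlt | heq
    · right
      rw [← map_comap_eq_self_of_surjective (QuotientGroup.mk'_surjective K) H, hK.2 _ hlt,
        ← MonoidHom.range_eq_map, MonoidHom.range_eq_top.mpr (QuotientGroup.mk'_surjective K)]
    · left
      rw [← map_comap_eq_self_of_surjective (QuotientGroup.mk'_surjective K) H, ← heq,
        QuotientGroup.map_mk'_self]
  exact CommGroup.is_simple_iff_prime_card.mp this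

theorem exists_normal_abelian_prime_exponent {G : Type*} [Group G] [Finite G] [Nontrivial G]
    [Group.IsSolvable G] : ∃ (p : ℕ) (V : Subgroup G), p.Prime ∧ V.Normal ∧ V ≠ ⊥ ∧
      (∀ a ∈ V, ∀ b ∈ V, a * b = b * a) ∧ ∀ a ∈ V, a ^ p = 1 := by
  obtain ⟨A, hA, hA1, hAc⟩ : ∃ A : Subgroup G, A.Normal ∧ A ≠ ⊥ ∧
      ∀ a ∈ A, ∀ b ∈ A, a * b = b * a := by
    classical
    have hs := Group.IsSolvable.solvable (G := G)
    have h0 : Nat.find hs ≠ 0 := by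
      intro h
      have := Nat.find_spec hs
      rw [h, derivedSeries_zero] at this
      exact top_ne_bot this
    obtain ⟨k, hk⟩ := Nat.exists_eq_succ_of_ne_zero h0
    refine ⟨derivedSeries G k, derivedSeries_normal G k,
      Nat.find_min hs (hk ▸ Nat.lt_succ_self k), fun a ha b hb => ?_⟩
    have h1 : derivedSeries G (k + 1) = ⊥ := by
      have := Nat.find_spec hs
      rwa [hk] at this
    rw [derivedSeries_succ] at h1
    have hab := commutator_mem_commutator ha hb
    rw [h1, mem_bot] at hab
    exact commutatorElement_eq_one_iff_mul_comm.mp hab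
  have hcard : Nat.card A ≠ 1 := fun h => hA1 (card_eq_one.mp h)
  obtain ⟨p, hp, hpA⟩ := Nat.exists_prime_and_dvd hcard
  have := Fact.mk hp
  obtain ⟨x, hx⟩ := exists_prime_orderOf_dvd_card' p hpA
  refine ⟨p, { carrier := {a | a ∈ A ∧ a ^ p = 1}
               mul_mem' := fun {a b} ha hb => ⟨A.mul_mem ha.1 hb.1, by
                rw [Commute.mul_pow (hAc a ha.1 b hb.1), ha.2, hb.2, one_mul]⟩
               one_mem' := ⟨A.one_mem, one_pow p⟩
               inv_mem' := fun {a} ha => ⟨A.inv_mem ha.1, by rw [inv_pow, ha.2, inv_one]⟩ },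
    hp, ⟨fun a ha g => ⟨hA.conj_mem a ha.1 g, by rw [conj_pow, ha.2]; simp⟩⟩, fun h => ?_,
    fun a ha b hb => hAc a ha.1 b hb.1, fun a ha => ha.2⟩
  have hmem : (x : G) ∈ (⊥ : Subgroup G) := h ▸ ⟨x.2, by
    have := pow_orderOf_eq_one x
    rw [hx] at this
    exact congrArg Subtype.val this⟩
  have hx1 : x = 1 := Subtype.ext (mem_bot.mp hmem)
  exact hp.one_lt.ne (by rw [← hx, hx1, orderOf_one])

theorem dvd_orderOf_of_isPGroup {G : Type*} [Group G] {p : ℕ} [Fact p.Prime] {H : Subgroup G}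
    (hH : IsPGroup p H) {a : G} (ha : a ∈ H) (ha1 : a ≠ 1) : p ∣ orderOf a := by
  obtain ⟨k, hk⟩ := IsPGroup.iff_orderOf.mp hH ⟨a, ha⟩
  rw [orderOf_mk] at hk
  rw [hk]
  refine dvd_pow_self p fun hk0 => ha1 ?_
  rwa [hk0, pow_zero, orderOf_eq_one_iff] at hk

/-- **Lucido's three primes lemma**. -/
theorem exists_orderOf_eq_mul_of_isSolvable {T : Finset ℕ} (hT : ∀ p ∈ T, p.Prime)
    (hT3 : 3 ≤ T.card) (n : ℕ) : ∀ (G : Type*) [Group G] [Finite G] [Group.IsSolvable G],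
    Nat.card G = n → (∀ p ∈ T, p ∣ Nat.card G) →
    ∃ s ∈ T, ∃ t ∈ T, s ≠ t ∧ ∃ g : G, orderOf g = s * t := by
  induction n using Nat.strong_induction_on with
  | _ n ih =>
  intro G _ _ _ hn hG
  by_contra hno
  have hcop {s t : ℕ} (hs : s ∈ T) (ht : t ∈ T) (hst : s ≠ t) : s.Coprime t :=
    (Nat.coprime_primes (hT s hs) (hT t ht)).mpr hst
  have hfree {a b : G} {s t : ℕ} (hs : s ∈ T) (ht : t ∈ T) (hst : s ≠ t) (hab : Commute a b)
      (ha : s ∣ orderOf a) (hb : t ∣ orderOf b) : False :=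
    hno ⟨s, hs, t, ht, hst, exists_orderOf_eq_mul_of_commute hab (hcop hs ht hst) ha hb⟩
  obtain ⟨p₀, hp₀⟩ : T.Nonempty := Finset.card_pos.mp (by omega)
  have : Nontrivial G := by
    rw [← Finite.one_lt_card_iff_nontrivial]
    exact (hT p₀ hp₀).one_lt.trans_le (Nat.le_of_dvd Nat.card_pos (hG p₀ hp₀))
  obtain ⟨p, V, hp, hVn, hV1, hVc, hVp⟩ := exists_normal_abelian_prime_exponent (G := G)
  obtain ⟨K, hKn, hK⟩ := exists_normal_prime_index (G := G)
  obtain ⟨l, hl⟩ : ∃ l, K.index = l := ⟨_, rfl⟩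
  rw [hl] at hK
  have := Fact.mk hp
  have := Fact.mk hK
  have hord {v : G} (hv : v ∈ V) (hv1 : v ≠ 1) : orderOf v = p :=
    orderOf_eq_prime (hVp v hv) hv1
  have hVpg : IsPGroup p V := fun v => ⟨1, Subtype.ext (by simpa using hVp v v.2)⟩
  obtain ⟨v, hv, hv1⟩ : ∃ v ∈ V, v ≠ 1 := (V.bot_or_exists_ne_one).resolve_left hV1
  have hpT : p ∈ T := by
    have hlt : Nat.card (G ⧸ V) < n := by
      have h1 := V.card_eq_card_quotient_mul_card_subgroup
      have h2 : 1 < Nat.card V := V.one_lt_card_iff_ne_bot.mpr hV1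
      rw [← hn, h1]
      exact lt_mul_of_one_lt_right Nat.card_pos h2
    have hex : ∃ s ∈ T, ¬ s ∣ Nat.card (G ⧸ V) := by
      by_contra! hall
      obtain ⟨s, hs, t, ht, hst, g, hg⟩ := ih _ hlt (G ⧸ V) rfl hall
      obtain ⟨g, rfl⟩ := QuotientGroup.mk'_surjective V g
      exact hno ⟨s, hs, t, ht, hst, exists_orderOf_eq_of_map _ hg⟩
    obtain ⟨s, hs, hsd⟩ := hex
    obtain rfl : s = p := by
      by_contra hsp
      obtain ⟨k, hk⟩ := IsPGroup.iff_card.mp hVpg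
      have h1 := hG s hs
      rw [V.card_eq_card_quotient_mul_card_subgroup, hk] at h1
      exact hsd (Nat.Coprime.dvd_of_dvd_mul_right
        (Nat.Coprime.pow_right k ((Nat.coprime_primes (hT s hs) hp).mpr hsp)) h1)
    exact hs
  have hKcard : Nat.card K * l = Nat.card G := hl ▸ K.card_mul_index
  have hKdvd {s : ℕ} (hs : s ∈ T) (hsl : s ≠ l) : s ∣ Nat.card K :=
    Nat.Coprime.dvd_of_dvd_mul_right ((Nat.coprime_primes (hT s hs) hK).mpr hsl)
      (hKcard ▸ hG s hs)
  obtain ⟨hlT, hlK⟩ : l ∈ T ∧ ¬ l ∣ Nat.card K := by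
    have hlt : Nat.card K < n := by
      rw [← hn, ← hKcard]
      exact lt_mul_of_one_lt_right Nat.card_pos hK.one_lt
    have hex : ∃ s ∈ T, ¬ s ∣ Nat.card K := by
      by_contra! hall
      obtain ⟨s, hs, t, ht, hst, g, hg⟩ := ih _ hlt K rfl hall
      exact hno ⟨s, hs, t, ht, hst, g, by rwa [orderOf_coe]⟩
    obtain ⟨s, hs, hsd⟩ := hex
    obtain rfl : s = l := by
      by_contra hsl
      exact hsd (hKdvd hs hsl)
    exact ⟨hs, hsd⟩
  obtain ⟨r, hr⟩ : ((T.erase p).erase l).Nonempty := by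
    apply Finset.card_pos.mp
    have := Finset.pred_card_le_card_erase (s := T) (a := p)
    have := Finset.pred_card_le_card_erase (s := T.erase p) (a := l)
    omega
  simp only [Finset.mem_erase] at hr
  obtain ⟨hrl, hrp, hrT⟩ := hr
  have := Fact.mk (hT r hrT)
  have hrK := hKdvd hrT hrl
  have hlp : l ≠ p := by
    rintro rfl
    obtain ⟨y, hy⟩ := exists_prime_orderOf_dvd_card' r hrK
    have hdis : Disjoint V K := by
      rw [disjoint_def]
      intro a haV haK
      by_contra ha1
      apply hlK
      have := orderOf_dvd_natCard (⟨a, haK⟩ : K)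
      rwa [orderOf_mk, hord haV ha1] at this
    exact hfree hpT hrT hrp.symm (commute_of_normal_of_disjoint V K hVn hKn hdis v y hv y.2)
      (hord hv hv1).symm.dvd (by rw [orderOf_coe, hy])
  obtain ⟨P⟩ : Nonempty (Sylow r K) := inferInstance
  set R : Subgroup G := (P : Subgroup K).map K.subtype with hR
  have hRpg : IsPGroup r R := P.isPGroup'.map _
  have hfrat : normalizer (R : Set G) ⊔ K = ⊤ := Sylow.normalizer_sup_eq_top P
  have hlN : l ∣ Nat.card (normalizer (R : Set G)) := by
    have h1 := relIndex_sup_right (normalizer (R : Set G)) K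
    rw [hfrat, relIndex_top_right, hl] at h1
    exact h1 ▸ relIndex_dvd_card K _
  obtain ⟨x, hx⟩ := exists_prime_orderOf_dvd_card' l hlN
  have hrP : r ∣ Nat.card P := P.dvd_card_of_dvd_card hrK
  obtain ⟨y, hy⟩ := exists_prime_orderOf_dvd_card' r hrP
  let _ : CommGroup V := { mul_comm := fun a b => Subtype.ext (hVc a a.2 b b.2) }
  have hfix {c : G} {s : ℕ} (hsT : s ∈ T) (hsp : s ≠ p) (hc : s ∣ orderOf c) (w : V)
      (hw : MulAut.conjNormal c w = w) : w = 1 := by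
    by_contra hw1
    have hcw : c * w * c⁻¹ = w := by rw [← MulAut.conjNormal_apply, hw]
    exact hfree hsT hpT hsp (mul_inv_eq_iff_eq_mul.mp hcw) hc
      (hord w.2 (by simpa using hw1)).symm.dvd
  have hfin := pow_card_eq_one_of_fixedPointFree (MulAut.conjNormal (H := V)) R
    (zpowers (x : G)) (by simp)
    ⟨y, mem_map_of_mem _ y.2, hfix hrT hrp (by rw [orderOf_coe, orderOf_coe, hy])⟩
    ⟨x, mem_zpowers _, hfix hlT hlp (by rw [orderOf_coe, hx])⟩
    (fun h hh hh1 a ha hha => by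
      by_contra ha1
      refine hfree hlT hrT hrl.symm hha ?_ (dvd_orderOf_of_isPGroup hRpg ha ha1)
      have h1 := orderOf_dvd_of_mem_zpowers hh
      rw [orderOf_coe, hx, Nat.dvd_prime hK, orderOf_eq_one_iff] at h1
      rw [h1.resolve_left hh1]) ⟨v, hv⟩
  have h1 : v ^ Nat.card R = 1 := congrArg Subtype.val hfin
  have h2 := orderOf_dvd_of_pow_eq_one h1
  obtain ⟨k, hk⟩ := IsPGroup.iff_card.mp hRpg
  rw [hord hv hv1, hk] at h2
  exact hrp ((Nat.prime_dvd_prime_iff_eq hp (hT r hrT)).mp (hp.dvd_of_dvd_pow h2)).symm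

theorem toPermHom_sylow_injective {S : Type*} [Group S] [Finite S] [IsSimpleGroup S] {p : ℕ}
    [Fact p.Prime] (h : Nat.card (Sylow p S) ≠ 1) :
    Function.Injective (MulAction.toPermHom S (Sylow p S)) := by
  rw [← MonoidHom.ker_eq_bot_iff]
  refine (MonoidHom.normal_ker _).eq_bot_or_eq_top.resolve_right fun htop => h ?_
  obtain ⟨P⟩ : Nonempty (Sylow p S) := inferInstance
  refine Nat.card_eq_one_iff_exists.mpr ⟨P, fun Q => ?_⟩
  obtain ⟨g, rfl⟩ := MulAction.exists_smul_eq S P Q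
  have hg : g ∈ (MulAction.toPermHom S (Sylow p S)).ker := htop ▸ mem_top g
  exact DFunLike.congr_fun (MonoidHom.mem_ker.mp hg) P

theorem card_sylow_two_of_isSimpleGroup {S : Type*} [Group S] [IsSimpleGroup S]
    (hS : Nat.card S = 60) : Nat.card (Sylow 2 S) = 5 := by
  have : Finite S := Nat.finite_of_card_ne_zero (by omega)
  obtain ⟨P⟩ : Nonempty (Sylow 2 S) := inferInstance
  have hcard : Nat.card P = 4 := by
    rw [P.card_eq_multiplicity, hS, show 60 = 2 ^ 2 * 15 by norm_num,
      Nat.factorization_mul (by norm_num) (by norm_num), Nat.Prime.factorization_pow Nat.prime_two]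
    simp [Nat.factorization_eq_zero_of_not_dvd (show ¬ 2 ∣ 15 by norm_num)]
  have hcard4 : Nat.card (P : Subgroup S) = 4 := hcard
  have hidx : (P : Subgroup S).index = 15 := by
    have := (P : Subgroup S).card_mul_index
    rw [hS, hcard] at this
    omega
  have hnormal (H : Subgroup S) (hH : H.Normal) (h1 : Nat.card H ≠ 1) : Nat.card H = 60 := by
    rcases hH.eq_bot_or_eq_top with rfl | rfl
    · simp at h1
    · simpa using hS
  have hne1 : Nat.card (Sylow 2 S) ≠ 1 := fun h => by
    rw [P.card_eq_index_normalizer, index_eq_one] at h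
    have h60 := hnormal P (normalizer_eq_top_iff.mp h) (by rw [hcard4]; norm_num)
    omega
  have hne3 : Nat.card (Sylow 2 S) ≠ 3 := fun h => by
    have := Nat.card_le_card_of_injective _ (toPermHom_sylow_injective (S := S) (p := 2) hne1)
    rw [Nat.card_perm, h, hS] at this
    simp [Nat.factorial] at this
  have hne15 : Nat.card (Sylow 2 S) ≠ 15 := fun h => by
    have hN : normalizer (P : Set S) = P := by
      refine (eq_of_le_of_card_ge le_normalizer ?_).symm
      have h1 := (normalizer (P : Set S)).card_mul_index
      rw [← P.card_eq_index_normalizer, h, hS] at h1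
      have h4 : Nat.card (normalizer (P : Set S)) = 4 := by omega
      exact (h4.trans hcard4.symm).le
    have hP : normalizer (P : Set S) ≤ centralizer (P : Set S) := by
      rw [hN]
      intro a ha b hb
      have hcomm := IsPGroup.isMulCommutative_of_card_eq_prime_sq (p := 2) (G := P)
        (by simpa using hcard)
      exact congrArg Subtype.val (hcomm.is_comm.comm (⟨b, hb⟩ : P) ⟨a, ha⟩)
    have h1 := (MonoidHom.ker_transferSylow_isComplement' P hP).index_eq_card
    have h2 := (MonoidHom.ker_transferSylow_isComplement' P hP).card_mul_card
    rw [hcard4, hS] at h2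
    have := hnormal _ (MonoidHom.normal_ker (MonoidHom.transferSylow P hP)) (by omega)
    omega
  have hdvd := P.card_dvd_index
  rw [hidx] at hdvd
  have hle := Nat.le_of_dvd (by norm_num) hdvd
  generalize Nat.card (Sylow 2 S) = m at *
  interval_cases m <;> omega

theorem nat_card_alternatingGroup_five : Nat.card (alternatingGroup (Fin 5)) = 60 := by
  rw [nat_card_alternatingGroup]; simp [Nat.factorial]

theorem exists_surjective_alternatingGroup_of_normal {K : Type*} [Group K] [Finite K]
    (S : Subgroup K) [S.Normal] (e : S ≃* alternatingGroup (Fin 5))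
    (h6 : ¬ ∃ g : K, orderOf g = 6) :
    ∃ φ : K →* alternatingGroup (Fin 5), Function.Surjective φ ∧ Disjoint φ.ker S ∧
      ¬ 2 ∣ Nat.card φ.ker := by
  have hS : Nat.card S = 60 := (Nat.card_congr e.toEquiv).trans nat_card_alternatingGroup_five
  have : IsSimpleGroup S := e.isSimpleGroup
  have hsyl := card_sylow_two_of_isSimpleGroup hS
  let ε : Sylow 2 S ≃ Fin 5 := Finite.equivFinOfCardEq hsyl
  let ψ : K →* Equiv.Perm (Fin 5) := ε.permCongrHom.toMonoidHom.comp
    ((MulAction.toPermHom (MulAut S) (Sylow 2 S)).comp MulAut.conjNormal)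
  have hψS : Function.Injective (ψ.comp S.subtype) := by
    have h1 : (MulAction.toPermHom (MulAut S) (Sylow 2 S)).comp
        (MulAut.conjNormal.comp S.subtype) = MulAction.toPermHom S (Sylow 2 S) := by
      ext s P : 2
      simp only [MonoidHom.comp_apply, MulAction.toPermHom_apply, MulAction.toPerm_apply,
        Sylow.smul_def, subtype_apply, MulAut.conjNormal_val]
    have h2 : ψ.comp S.subtype =
        ε.permCongrHom.toMonoidHom.comp (MulAction.toPermHom S (Sylow 2 S)) := by
      rw [← h1]; rfl
    rw [h2]
    exact ε.permCongrHom.injective.comp (toPermHom_sylow_injective (by omega))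
  have hrange : 60 ≤ Nat.card ψ.range := by
    rw [← hS]
    exact Nat.card_le_card_of_injective (fun s : S => (⟨ψ s, s, rfl⟩ : ψ.range))
      fun a b hab => hψS (congrArg Subtype.val hab)
  have hmul := ψ.range.card_mul_index
  rw [Nat.card_perm, Nat.card_fin, show Nat.factorial 5 = 120 from rfl] at hmul
  have hidx1 : ψ.range.index ≠ 1 := fun h => by
    rw [index_eq_one, MonoidHom.range_eq_top] at h
    have h2 : orderOf (Equiv.swap (0 : Fin 5) 1) = 2 :=
      Equiv.Perm.IsSwap.orderOf ⟨0, 1, by decide, rfl⟩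
    have h3 : orderOf (Equiv.swap (2 : Fin 5) 3 * Equiv.swap 2 4) = 3 :=
      (Equiv.Perm.isThreeCycle_swap_mul_swap_same (by decide) (by decide) (by decide)).orderOf
    obtain ⟨x, hx⟩ := exists_orderOf_eq_mul_of_commute
      (a := Equiv.swap (0 : Fin 5) 1) (b := Equiv.swap (2 : Fin 5) 3 * Equiv.swap 2 4)
      (by rw [commute_iff_eq]; decide) (by norm_num : Nat.Coprime 2 3) h2.symm.dvd h3.symm.dvd
    obtain ⟨y, rfl⟩ := h x
    exact h6 (exists_orderOf_eq_of_map ψ hx)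
  have hidx : ψ.range.index = 2 := by
    have h0 : ψ.range.index ≠ 0 := by rintro h; simp [h] at hmul
    have h3 : ψ.range.index < 3 := by
      by_contra! h
      have := Nat.mul_le_mul hrange h
      omega
    omega
  have hA := Equiv.Perm.eq_alternatingGroup_of_index_eq_two hidx
  let φ : K →* alternatingGroup (Fin 5) :=
    ψ.codRestrict (alternatingGroup (Fin 5)) fun k => hA ▸ ⟨k, rfl⟩
  have hker : φ.ker = ψ.ker := MonoidHom.ker_codRestrict _ _ _
  have hdis : Disjoint φ.ker S := by
    rw [hker, disjoint_def]
    intro a ha haS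
    have : (⟨a, haS⟩ : S) = 1 := hψS (by simpa using ha)
    exact congrArg Subtype.val this
  refine ⟨φ, ?_, hdis, fun h => ?_⟩
  · rintro ⟨σ, hσ⟩
    rw [← hA] at hσ
    obtain ⟨k, hk⟩ := hσ
    exact ⟨k, Subtype.ext hk⟩
  · obtain ⟨d, hd⟩ := exists_prime_orderOf_dvd_card' 2 h
    obtain ⟨s, hs⟩ := exists_prime_orderOf_dvd_card' (G := S) 3 (by rw [hS]; norm_num)
    exact h6 (exists_orderOf_eq_mul_of_commute
      (commute_of_normal_of_disjoint _ _ (MonoidHom.normal_ker φ) ‹_› hdis d s d.2 s.2)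
      (by norm_num : Nat.Coprime 2 3) (by rw [orderOf_coe, hd]) (by rw [orderOf_coe, hs]))

/-- The group is solvable, or an extension of `A₅` by a solvable normal subgroup. -/
def IsSolvableOrSolvableByA5 (G : Type*) [Group G] : Prop :=
  Group.IsSolvable G ∨
    ∃ f : G →* alternatingGroup (Fin 5), Function.Surjective f ∧ Group.IsSolvable f.ker

theorem not_isSolvable_alternatingGroup_five : ¬ Group.IsSolvable (alternatingGroup (Fin 5)) := by
  rw [← IsSimpleGroup.comm_iff_isSolvable]
  intro h
  let _ : CommGroup (alternatingGroup (Fin 5)) := { mul_comm := h }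
  have := CommGroup.is_simple_iff_prime_card.mp
    (inferInstance : IsSimpleGroup (alternatingGroup (Fin 5)))
  rw [nat_card_alternatingGroup_five] at this
  norm_num at this

theorem ker_characteristic_of_surjective_alternatingGroup {L : Type*} [Group L]
    {g : L →* alternatingGroup (Fin 5)} (hg : Function.Surjective g) [Group.IsSolvable g.ker] :
    g.ker.Characteristic := by
  rw [characteristic_iff_map_le]
  intro φ
  have hn : ((g.ker.map φ.toMonoidHom).map g).Normal :=
    Normal.map (Normal.map inferInstance _ φ.surjective) g hg
  have hs : Group.IsSolvable (g.ker.map φ.toMonoidHom) :=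
    Group.isSolvable_of_surjective (φ.toMonoidHom.subgroupMap_surjective g.ker)
  have hs' : Group.IsSolvable ((g.ker.map φ.toMonoidHom).map g) :=
    Group.isSolvable_of_surjective (g.subgroupMap_surjective _)
  rcases hn.eq_bot_or_eq_top with h | h
  · exact (Subgroup.map_eq_bot_iff _).mp h
  · rw [h] at hs'
    exact absurd (Group.isSolvable_of_surjective
      (f := (topEquiv (G := alternatingGroup (Fin 5))).toMonoidHom) topEquiv.surjective)
      not_isSolvable_alternatingGroup_five

theorem isSolvable_of_disjoint_ker {K S : Type*} [Group K] [Finite K] [Group S] [IsSimpleGroup S]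
    (D : Subgroup K) [D.Normal] (hD2 : ¬ 2 ∣ Nat.card D) (f : K →* S) (hf : Function.Surjective f)
    (hdis : Disjoint D f.ker) (hS : IsCyclic S ∨ Nonempty (S ≃* alternatingGroup (Fin 5))) :
    Group.IsSolvable D := by
  have hinj : Function.Injective (f.comp D.subtype) := by
    rw [injective_iff_map_eq_one]
    intro d hd
    exact Subtype.ext (disjoint_def.mp hdis d.2 hd)
  rcases hS with hS | ⟨⟨e⟩⟩
  · let _ : CommGroup S := IsCyclic.commGroup
    exact Group.isSolvable_of_isSolvable_injective hinj
  · have hn : (D.map f).Normal := Normal.map inferInstance f hf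
    have hcard : Nat.card (D.map f) ∣ Nat.card D := D.card_map_dvd f
    rcases hn.eq_bot_or_eq_top with h | h
    · have : Subsingleton D := ⟨fun a b => hinj (by
        have (x : D) : f x = 1 := by
          have := mem_map_of_mem f x.2
          rwa [h, mem_bot] at this
        simp [this])⟩
      infer_instance
    · refine absurd (dvd_trans ?_ hcard) hD2
      rw [h, card_top, Nat.card_congr e.toEquiv, nat_card_alternatingGroup_five]
      norm_num

theorem IsSolvableOrSolvableByA5.of_surjective {H S : Type*} [Group H] [Finite H] [Group S]
    [IsSimpleGroup S] (h6 : ¬ ∃ g : H, orderOf g = 6) (f : H →* S) (hf : Function.Surjective f)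
    (hS : IsCyclic S ∨ Nonempty (S ≃* alternatingGroup (Fin 5)))
    (hL : IsSolvableOrSolvableByA5 f.ker) : IsSolvableOrSolvableByA5 H := by
  rcases hL with hL | ⟨g, hg, hgs⟩
  · rcases hS with hS | ⟨⟨e⟩⟩
    · let _ : CommGroup S := IsCyclic.commGroup
      exact .inl (Group.isSolvable_of_ker_le_range f.ker.subtype f (by simp))
    · refine .inr ⟨e.toMonoidHom.comp f, e.surjective.comp hf, ?_⟩
      have hker : (e.toMonoidHom.comp f).ker = f.ker := by
        ext x
        simp [MonoidHom.mem_ker]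
      rwa [hker]
  have : g.ker.Characteristic := ker_characteristic_of_surjective_alternatingGroup hg
  set R : Subgroup H := g.ker.map f.ker.subtype with hR
  have hRn : R.Normal := inferInstance
  have hRle : R ≤ f.ker := map_subtype_le _
  have hRs : Group.IsSolvable R :=
    Group.isSolvable_of_surjective (f.ker.subtype.subgroupMap_surjective g.ker)
  let π := QuotientGroup.mk' R
  let j : f.ker →* H ⧸ R := π.comp f.ker.subtype
  have hjker : j.ker = g.ker := by
    ext x
    rw [MonoidHom.mem_ker]
    change ((x : H) : H ⧸ R) = 1 ↔ _
    rw [QuotientGroup.eq_one_iff, hR]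
    exact mem_map_iff_mem f.ker.subtype_injective
  have hjn : j.range.Normal := by
    rw [MonoidHom.range_comp, range_subtype]
    exact Normal.map inferInstance π (QuotientGroup.mk'_surjective R)
  let e : j.range ≃* alternatingGroup (Fin 5) :=
    (QuotientGroup.quotientKerEquivRange j).symm.trans
      ((QuotientGroup.quotientMulEquivOfEq hjker).trans
        (QuotientGroup.quotientKerEquivOfSurjective g hg))
  obtain ⟨φ, hφ, hdis, hodd⟩ := exists_surjective_alternatingGroup_of_normal j.range e
    fun ⟨x, hx⟩ => by
      obtain ⟨x, rfl⟩ := QuotientGroup.mk'_surjective R x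
      exact h6 (exists_orderOf_eq_of_map _ hx)
  let f' : H ⧸ R →* S := QuotientGroup.lift R f hRle
  have hf' : Function.Surjective f' := QuotientGroup.lift_surjective_of_surjective R f hf hRle
  have hker : f'.ker ≤ j.range := by
    intro x hx
    obtain ⟨x, rfl⟩ := QuotientGroup.mk'_surjective R x
    exact ⟨⟨x, hx⟩, rfl⟩
  have hD := isSolvable_of_disjoint_ker φ.ker hodd f' hf' (hdis.mono_right hker) hS
  refine .inr ⟨φ.comp π, hφ.comp (QuotientGroup.mk'_surjective R), ?_⟩
  have hRE : R ≤ (φ.comp π).ker := fun x hx => by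
    have : π x = 1 := (QuotientGroup.eq_one_iff x).mpr hx
    simp [MonoidHom.mem_ker, this]
  refine Group.isSolvable_of_ker_le_range (inclusion hRE) (π.subgroupComap φ.ker) fun x hx => ?_
  refine ⟨⟨x, (QuotientGroup.eq_one_iff (x : H)).mp (congrArg Subtype.val hx)⟩, rfl⟩

theorem IsSolvableOrSolvableByA5.of_mulEquiv {G H : Type*} [Group G] [Group H] (e : G ≃* H)
    (hH : IsSolvableOrSolvableByA5 H) : IsSolvableOrSolvableByA5 G := by
  rcases hH with h | ⟨f, hf, hs⟩
  · exact .inl (Group.isSolvable_of_isSolvable_injective (f := e.toMonoidHom) e.injective)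
  · refine .inr ⟨f.comp e.toMonoidHom, hf.comp e.surjective, ?_⟩
    exact Group.isSolvable_of_isSolvable_injective (f := e.toMonoidHom.subgroupComap f.ker)
      fun a b hab => Subtype.ext (e.injective (congrArg Subtype.val hab))

theorem IsPseudoSolvable.isSolvableOrSolvableByA5 {G : Type*} [Group G] [Finite G]
    (hG : IsPseudoSolvable G) (h6 : ¬ ∃ g : G, orderOf g = 6) : IsSolvableOrSolvableByA5 G := by
  obtain ⟨n, c, h0, hlast, hc⟩ := hG
  have key (i : Fin (n + 1)) : IsSolvableOrSolvableByA5 (c i) := by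
    induction i using Fin.induction with
    | zero =>
      rw [h0]
      exact .inl inferInstance
    | succ i ih =>
      obtain ⟨hle, S, _, f, hf, hker, hS, hS'⟩ := hc i
      refine .of_surjective (fun ⟨x, hx⟩ => h6 ⟨x, by rwa [orderOf_coe]⟩) f hf hS' ?_
      rw [hker]
      exact ih.of_mulEquiv (subgroupOfEquivOfLe hle)
  have htop := key (Fin.last n)
  rw [hlast] at htop
  exact htop.of_mulEquiv topEquiv.symm

end

/-- If `G` is a finite pseudo-solvable group, `2`, `3`, `5` all divide `|G|`, and
`G` has no element of order `6`, `10`, or `15` (i.e. `{2,3,5}` is a triangle in the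
complement of the prime graph), then there are normal subgroups `N ≤ M` of `G` with
`N` solvable, `M/N ≅ A₅`, and `G/M` solvable of order coprime to `30`. -/
theorem stmt_15 (G : Type*) [Group G] [Finite G] (hps : IsPseudoSolvable G)
    (h2 : 2 ∣ Nat.card G) (h3 : 3 ∣ Nat.card G) (h5 : 5 ∣ Nat.card G)
    (h6 : ¬ ∃ g : G, orderOf g = 6)
    (h10 : ¬ ∃ g : G, orderOf g = 10)
    (h15 : ¬ ∃ g : G, orderOf g = 15) :
    ∃ (N M : Subgroup G), N ≤ M ∧ N.Normal ∧ M.Normal ∧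
      IsSolvable ↥N ∧
      (∃ f : ↥M →* alternatingGroup (Fin 5),
        Function.Surjective f ∧ f.ker = N.subgroupOf M) ∧
      (∃ (Q : Type) (_ : Group Q) (g : G →* Q),
        Function.Surjective g ∧ g.ker = M ∧
        IsSolvable Q ∧ Nat.Coprime (Nat.card Q) 30) := by
  rcases hps.isSolvableOrSolvableByA5 h6 with hs | ⟨f, hf, hs⟩
  · obtain ⟨s, hs, t, ht, hst, g, hg⟩ := exists_orderOf_eq_mul_of_isSolvable
      (T := {2, 3, 5}) (by intro p hp; fin_cases hp <;> norm_num) (by decide) _ G rfl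
      (by intro p hp; fin_cases hp <;> assumption)
    exfalso
    fin_cases hs <;> fin_cases ht <;> first
      | exact hst rfl
      | exact h6 ⟨g, hg⟩
      | exact h10 ⟨g, hg⟩
      | exact h15 ⟨g, hg⟩
  · refine ⟨f.ker, ⊤, le_top, inferInstance, inferInstance, hs,
      ⟨f.comp (⊤ : Subgroup G).subtype, fun a => ?_, rfl⟩,
      ⟨Unit, inferInstance, 1, fun _ => ⟨1, rfl⟩, MonoidHom.ker_one,
        (inferInstance : Group.IsSolvable Unit), by simp⟩⟩
    obtain ⟨x, rfl⟩ := hf a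
    exact ⟨⟨x, trivial⟩, rfl⟩
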